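/- For every T ≥ 1, every K ≥ e^{12}, every σ > 0, every threshold τ ∈ ℝ, and every fixed-budget strategy π with budget T, there exists a K-armed bandit problem ν whose arm distributions are all Gaussian with variance σ² and whose mean sequence is concave (μ_{k−1} + μ_{k+1} ≤ 2μ_k at all interior indices), such that the expected simple regret satisfies R̄_T^{ν,π} ≥ (1/8)·√( σ²·max(2, log(log(K) − 1)) / (8T) ). -/

import Mathlib

open MeasureTheory Real

namespace TBP

/-- A `K`-armed bandit problem: a probability distribution on `ℝ` for each arm. -/
structure Bandit (K : ℕ) where
  dist : Fin K → Measure ℝ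
  prob : ∀ k, IsProbabilityMeasure (dist k)

/-- The mean of arm `k`. -/
noncomputable def Bandit.mean {K : ℕ} (ν : Bandit K) (k : Fin K) : ℝ := ∫ x, x ∂ ν.dist k

/-- The unstructured class `B`: all arm distributions are supported in `[0,1]`. -/
def Bandit.inB {K : ℕ} (ν : Bandit K) : Prop := ∀ k, ν.dist k (Set.Icc (0:ℝ) 1) = 1

/-- All arms are `σ²`-sub-Gaussian. -/
def Bandit.subG {K : ℕ} (σ : ℝ) (ν : Bandit K) : Prop :=
  ∀ k, ∀ t : ℝ, ∫ x, Real.exp (t * (x - ν.mean k)) ∂ ν.dist k ≤ Real.exp (σ ^ 2 * t ^ 2 / 2)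

/-- All arms are Gaussian with variance `σ²`. -/
def Bandit.isGaussian {K : ℕ} (σ : ℝ) (ν : Bandit K) : Prop :=
  ∃ m : Fin K → ℝ, ∀ k, ν.dist k = ProbabilityTheory.gaussianReal (m k) ⟨σ ^ 2, sq_nonneg σ⟩

/-- The monotone (nondecreasing means) shape constraint. -/
def Bandit.mono {K : ℕ} (ν : Bandit K) : Prop := Monotone ν.mean

/-- The unimodal shape constraint. -/
def Bandit.unimodal {K : ℕ} (ν : Bandit K) : Prop :=
  ∃ kstar : Fin K, (∀ i j : Fin K, i ≤ j → j ≤ kstar → ν.mean i ≤ ν.mean j) ∧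
    (∀ i j : Fin K, kstar ≤ i → i ≤ j → ν.mean j ≤ ν.mean i)

/-- The concave shape constraint: `μ_{k-1} + μ_{k+1} ≤ 2 μ_k` at interior indices. -/
def Bandit.concave {K : ℕ} (ν : Bandit K) : Prop :=
  ∀ k : ℕ, ∀ (h0 : 0 < k) (h1 : k + 1 < K),
    ν.mean ⟨k - 1, by omega⟩ + ν.mean ⟨k + 1, h1⟩ ≤ 2 * ν.mean ⟨k, by omega⟩

/-- A fixed-budget strategy with budget `T` on `K` arms: a measurable sampling policy
(choosing the next arm from past observations) and a measurable final classification. -/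
structure Strategy (K T : ℕ) where
  policy : (t : ℕ) → (Fin t → ℝ) → Fin K
  policy_meas : ∀ t, Measurable (policy t)
  decision : (Fin T → ℝ) → Fin K → Bool
  decision_meas : Measurable decision

/-- Law of the first `t` observations produced by playing `policy` on the bandit `ν`. -/
noncomputable def traj {K : ℕ} (ν : Bandit K) (policy : (t : ℕ) → (Fin t → ℝ) → Fin K) :
    (t : ℕ) → Measure (Fin t → ℝ)
  | 0 => Measure.dirac (fun i => Fin.elim0 i)
  | (t + 1) => (traj ν policy t).bind
      (fun h => (ν.dist (policy t h)).map (fun y => Fin.snoc h y))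

/-- The true classification of arm `k` (`true` iff `μ_k ≥ τ`). -/
noncomputable def trueQ {K : ℕ} (ν : Bandit K) (τ : ℝ) (k : Fin K) : Bool :=
  decide (τ ≤ ν.mean k)

/-- Simple regret of the classification `Qhat`: the largest gap `|τ - μ_k|` over misclassified
arms `k` (and `0` if there is none). -/
noncomputable def regret {K : ℕ} (ν : Bandit K) (τ : ℝ) (Qhat : Fin K → Bool) : ℝ :=
  ((Finset.univ.filter (fun k => Qhat k ≠ trueQ ν τ k)).sup
    (fun k => Real.toNNReal |τ - ν.mean k|) : NNReal)

/-- Expected simple regret of the strategy `π` on the bandit problem `ν`. -/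
noncomputable def expRegret {K T : ℕ} (ν : Bandit K) (alg : Strategy K T) (τ : ℝ) : ℝ :=
  ∫ h, regret ν τ (alg.decision h) ∂ (traj ν alg.policy T)

/-- Minimax expected simple regret over the class `C` of `K`-armed bandit problems. -/
noncomputable def minimax (K T : ℕ) (τ : ℝ) (C : Bandit K → Prop) : ℝ :=
  ⨅ alg : Strategy K T, ⨆ ν : {ν : Bandit K // C ν}, expRegret ν.1 alg τ


/-- Empirical mean of arm `k` under the Uniform strategy: averages the `⌊T/K⌋` samples of arm `k`
(samples of arm `k` are taken at the times `t` with `⌊t/⌊T/K⌋⌋ = k`). -/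
noncomputable def uniformEmp (K T : ℕ) (k : Fin K) (h : Fin T → ℝ) : ℝ :=
  (∑ t ∈ Finset.univ.filter (fun t : Fin T => (t : ℕ) / (T / K) = (k : ℕ)), h t) / (T / K : ℕ)

/-- The Uniform strategy: sample each arm `⌊T/K⌋` times and classify each arm by comparing its
sample mean to the threshold `τ`. -/
noncomputable def uniformStrategy (K T : ℕ) (hK : 0 < K) (τ : ℝ) : Strategy K T where
  policy := fun t _ => ⟨(t / (T / K)) % K, Nat.mod_lt _ hK⟩
  policy_meas := fun _ => measurable_const
  decision := fun h k => decide (τ ≤ uniformEmp K T k h)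
  decision_meas := by
    apply measurable_pi_lambda
    intro k
    have hm : Measurable (fun h : Fin T → ℝ => uniformEmp K T k h) := by
      unfold uniformEmp; fun_prop
    have hset : MeasurableSet {h : Fin T → ℝ | τ ≤ uniformEmp K T k h} :=
      measurableSet_le measurable_const hm
    have heq : (fun h : Fin T → ℝ => decide (τ ≤ uniformEmp K T k h))
        = fun h => if τ ≤ uniformEmp K T k h then true else false := by
      funext h
      by_cases hc : τ ≤ uniformEmp K T k h <;> simp [hc]
    rw [heq]
    exact Measurable.ite hset measurable_const measurable_const

end TBP

open ProbabilityTheory in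
/-- The chi-square change-of-measure inequality between two Gaussians with equal variance. -/
theorem sq_lintegral_gaussianReal_le (m c : ℝ) {v : NNReal} (hv : v ≠ 0) {f : ℝ → ENNReal}
    (hf : Measurable f) :
    (∫⁻ x, f x ∂gaussianReal m v) ^ 2
      ≤ ENNReal.ofReal (exp ((m - c) ^ 2 / v)) * ∫⁻ x, f x ^ 2 ∂gaussianReal c v := by
  have hv' : (v : ℝ) ≠ 0 := by exact_mod_cast hv
  set a : ℝ → ENNReal := fun x => ENNReal.ofReal √(gaussianPDFReal c v x)
  set b : ℝ → ENNReal := fun x => ENNReal.ofReal (gaussianPDFReal m v x / √(gaussianPDFReal c v x))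
  have ha : Measurable a := by fun_prop
  have hb : Measurable b := by fun_prop
  have hpos := fun x => gaussianPDFReal_pos c v x hv
  have hab (x : ℝ) : gaussianPDF m v x * f x = (f x * a x) * b x := by
    have : a x * b x = gaussianPDF m v x := by
      rw [gaussianPDF_def, ← ENNReal.ofReal_mul (Real.sqrt_nonneg _),
        mul_div_cancel₀ _ (Real.sqrt_pos.2 (hpos x)).ne']
    rw [mul_assoc, this, mul_comm]
  have ha2 (x : ℝ) : (f x * a x) ^ 2 = gaussianPDF c v x * f x ^ 2 := by
    rw [mul_pow, mul_comm, ← ENNReal.ofReal_pow (Real.sqrt_nonneg _), Real.sq_sqrt (hpos x).le,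
      gaussianPDF_def]
  have hb2 (x : ℝ) :
      b x ^ 2 = ENNReal.ofReal (exp ((m - c) ^ 2 / v)) * gaussianPDF (2 * m - c) v x := by
    rw [← ENNReal.ofReal_pow (div_nonneg (gaussianPDFReal_nonneg _ _ _) (Real.sqrt_nonneg _)),
      div_pow, Real.sq_sqrt (hpos x).le, gaussianPDF_def, ← ENNReal.ofReal_mul (exp_pos _).le]
    congr 1
    rw [div_eq_iff (hpos x).ne']
    have hexp : exp (-(x - m) ^ 2 / (2 * v)) ^ 2 = exp ((m - c) ^ 2 / v)
        * exp (-(x - (2 * m - c)) ^ 2 / (2 * v)) * exp (-(x - c) ^ 2 / (2 * v)) := by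
      rw [← Real.exp_nat_mul, ← Real.exp_add, ← Real.exp_add]
      congr 1
      push_cast
      field_simp
      ring
    simp only [gaussianPDFReal_def]
    rw [mul_pow, hexp]
    ring
  have hle := ENNReal.lintegral_mul_le_Lp_mul_Lq volume Real.HolderConjugate.two_two
    (hf.mul ha).aemeasurable hb.aemeasurable
  simp only [Pi.mul_apply, ENNReal.rpow_two, ha2, hb2] at hle
  rw [lintegral_const_mul _ (measurable_gaussianPDF _ _), lintegral_gaussianPDF_eq_one _ hv,
    mul_one] at hle
  rw [gaussianReal_of_var_ne_zero _ hv, gaussianReal_of_var_ne_zero _ hv,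
    lintegral_withDensity_eq_lintegral_mul _ (measurable_gaussianPDF _ _) hf,
    lintegral_withDensity_eq_lintegral_mul _ (measurable_gaussianPDF _ _) (hf.pow_const 2)]
  simp only [Pi.mul_apply, hab]
  refine (pow_le_pow_left' hle 2).trans_eq ?_
  rw [mul_pow, ← ENNReal.rpow_mul_natCast, ← ENNReal.rpow_mul_natCast, mul_comm]
  norm_num

namespace TBP

theorem measurable_snoc_prod (t : ℕ) :
    Measurable (fun q : (Fin t → ℝ) × ℝ => (Fin.snoc q.1 q.2 : Fin (t + 1) → ℝ)) := by
  refine measurable_pi_lambda _ fun i => ?_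
  induction i using Fin.lastCases with
  | last => simpa using measurable_snd
  | cast i =>
    simp only [Fin.snoc_castSucc]
    fun_prop

/-- The law of the next observation given the history. -/
noncomputable def armKernel {K t : ℕ} (ν : Bandit K) {p : (Fin t → ℝ) → Fin K}
    (hp : Measurable p) : ProbabilityTheory.Kernel (Fin t → ℝ) ℝ :=
  ⟨fun h => ν.dist (p h), Measurable.of_discrete.comp hp⟩

instance {K t : ℕ} (ν : Bandit K) {p : (Fin t → ℝ) → Fin K} (hp : Measurable p) :
    ProbabilityTheory.IsMarkovKernel (armKernel ν hp) :=
  ⟨fun h => ν.prob (p h)⟩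

theorem measurable_snoc_arm {K t : ℕ} (ν : Bandit K) {p : (Fin t → ℝ) → Fin K}
    (hp : Measurable p) :
    Measurable (fun h => (ν.dist (p h)).map (fun y => (Fin.snoc h y : Fin (t + 1) → ℝ))) := by
  refine Measure.measurable_of_measurable_coe _ fun s hs => ?_
  have := ProbabilityTheory.Kernel.measurable_kernel_prodMk_left (κ := armKernel ν hp)
    (measurable_snoc_prod t hs)
  convert this using 2 with h
  exact Measure.map_apply ((measurable_snoc_prod t).comp measurable_prodMk_left) hs

theorem lintegral_traj_succ {K : ℕ} (ν : Bandit K) {p : (t : ℕ) → (Fin t → ℝ) → Fin K}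
    (hp : ∀ t, Measurable (p t)) (t : ℕ) {f : (Fin (t + 1) → ℝ) → ENNReal} (hf : Measurable f) :
    ∫⁻ h, f h ∂traj ν p (t + 1)
      = ∫⁻ h, ∫⁻ y, f (Fin.snoc h y) ∂ν.dist (p t h) ∂traj ν p t := by
  rw [traj, Measure.lintegral_bind (measurable_snoc_arm ν (hp t)).aemeasurable hf.aemeasurable]
  refine lintegral_congr fun h => ?_
  exact lintegral_map hf ((measurable_snoc_prod t).comp measurable_prodMk_left)

theorem isProbabilityMeasure_traj {K : ℕ} (ν : Bandit K) {p : (t : ℕ) → (Fin t → ℝ) → Fin K}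
    (hp : ∀ t, Measurable (p t)) (t : ℕ) : IsProbabilityMeasure (traj ν p t) := by
  induction t with
  | zero => rw [traj]; infer_instance
  | succ t ih =>
    have := ν.prob
    refine ⟨?_⟩
    rw [← lintegral_one, lintegral_traj_succ ν hp t measurable_const]
    simp

/-- A second-moment change-of-measure inequality for single arms extends to the law of the
observations. -/
theorem sq_lintegral_traj_le {K : ℕ} (ν ν' : Bandit K) {p : (t : ℕ) → (Fin t → ℝ) → Fin K}
    (hp : ∀ t, Measurable (p t)) {C : ENNReal}
    (hC : ∀ k, ∀ f : ℝ → ENNReal, Measurable f →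
      (∫⁻ y, f y ∂ν.dist k) ^ 2 ≤ C * ∫⁻ y, f y ^ 2 ∂ν'.dist k)
    (t : ℕ) {f : (Fin t → ℝ) → ENNReal} (hf : Measurable f) :
    (∫⁻ h, f h ∂traj ν p t) ^ 2 ≤ C ^ t * ∫⁻ h, f h ^ 2 ∂traj ν' p t := by
  induction t with
  | zero =>
    simp [traj, lintegral_dirac' _ hf, lintegral_dirac' _ (hf.pow_const 2)]
  | succ t ih =>
    have hsnoc := hf.comp (measurable_snoc_prod t)
    have hg (μ : Bandit K) {f : (Fin (t + 1) → ℝ) → ENNReal} (hf : Measurable f) :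
        Measurable fun h => ∫⁻ y, f (Fin.snoc h y) ∂μ.dist (p t h) :=
      (hf.comp (measurable_snoc_prod t)).lintegral_kernel_prod_right' (κ := armKernel μ (hp t))
    rw [lintegral_traj_succ ν hp t hf, lintegral_traj_succ ν' hp t (hf.pow_const 2)]
    refine (ih (hg ν hf)).trans ?_
    rw [pow_succ, mul_assoc, ← lintegral_const_mul _ (hg ν' (hf.pow_const 2))]
    gcongr with h
    exact hC _ _ (hsnoc.comp measurable_prodMk_left)

theorem abs_gap_le_regret {K : ℕ} (ν : Bandit K) (τ : ℝ) {Q : Fin K → Bool} {k : Fin K}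
    (hk : Q k ≠ trueQ ν τ k) : |τ - ν.mean k| ≤ regret ν τ Q := by
  have := Finset.le_sup (s := Finset.univ.filter fun k => Q k ≠ trueQ ν τ k)
    (f := fun k => Real.toNNReal |τ - ν.mean k|) (Finset.mem_filter.2 ⟨Finset.mem_univ k, hk⟩)
  exact (Real.le_coe_toNNReal _).trans (NNReal.coe_le_coe.2 this)

theorem mul_le_expRegret {K T : ℕ} (ν : Bandit K) (alg : Strategy K T) {τ ε : ℝ}
    {A : Set (Fin T → ℝ)} (hA : MeasurableSet A)
    (h : ∀ x ∉ A, ε ≤ regret ν τ (alg.decision x)) :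
    ε * (1 - (traj ν alg.policy T).real A) ≤ expRegret ν alg τ := by
  have := isProbabilityMeasure_traj ν alg.policy_meas T
  have := Measure.isProbabilityMeasure_map (μ := traj ν alg.policy T)
    alg.decision_meas.aemeasurable
  have hint : Integrable (fun x => regret ν τ (alg.decision x)) (traj ν alg.policy T) :=
    (Integrable.of_finite (f := regret ν τ)).comp_measurable alg.decision_meas
  rw [← probReal_compl_eq_one_sub hA, mul_comm, ← smul_eq_mul,
    ← integral_indicator_const _ hA.compl]
  refine integral_mono ((integrable_const ε).indicator hA.compl) hint fun x => ?_
  by_cases hx : x ∈ A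
  · simp only [Set.indicator, Set.mem_compl_iff, hx, not_true, if_false]
    exact NNReal.coe_nonneg _
  · simpa [Set.indicator, hx] using h x hx

/-- The Gaussian bandit with means `m` and common variance `v`. -/
noncomputable def gaussianBandit {K : ℕ} (m : Fin K → ℝ) (v : NNReal) : Bandit K where
  dist k := ProbabilityTheory.gaussianReal (m k) v
  prob _ := inferInstance

@[simp]
theorem mean_gaussianBandit {K : ℕ} (m : Fin K → ℝ) (v : NNReal) (k : Fin K) :
    (gaussianBandit m v).mean k = m k :=
  ProbabilityTheory.integral_id_gaussianReal

theorem sq_traj_real_le {K T : ℕ} (alg : Strategy K T) (m : Fin K → ℝ) (c : ℝ) {v : NNReal}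
    (hv : v ≠ 0) {D : ℝ} (hm : ∀ k, (m k - c) ^ 2 / v ≤ D) {A : Set (Fin T → ℝ)}
    (hA : MeasurableSet A) :
    (traj (gaussianBandit m v) alg.policy T).real A ^ 2
      ≤ exp (T * D) * (traj (gaussianBandit (fun _ => c) v) alg.policy T).real A := by
  have := isProbabilityMeasure_traj (gaussianBandit m v) alg.policy_meas T
  have := isProbabilityMeasure_traj (gaussianBandit (fun _ => c) v) alg.policy_meas T
  have key := sq_lintegral_traj_le (gaussianBandit m v) (gaussianBandit (fun _ => c) v)
    alg.policy_meas (C := ENNReal.ofReal (exp D)) (fun k f hf =>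
      (sq_lintegral_gaussianReal_le (m k) c hv hf).trans
        (mul_le_mul_left (ENNReal.ofReal_le_ofReal (exp_le_exp.2 (hm k))) _)) T
    (f := A.indicator 1) (measurable_one.indicator hA)
  have hsq (x : Fin T → ℝ) :
      A.indicator (1 : (Fin T → ℝ) → ENNReal) x ^ 2 = A.indicator 1 x := by
    by_cases hx : x ∈ A <;> simp [hx]
  simp only [hsq, lintegral_indicator_one hA] at key
  rw [← ENNReal.ofReal_pow (exp_pos _).le, ← Real.exp_nat_mul] at key
  have := ENNReal.toReal_mono (by finiteness) key
  simpa [Measure.real, ENNReal.toReal_mul, (exp_pos _).le] using this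

/-- The means rise linearly from about `τ - 3S/4` to `τ + S/4`, reached at (one-based) arm
`2 ^ j`, and are constant afterwards. -/
noncomputable def rampMean (K : ℕ) (τ S : ℝ) (j : ℕ) (k : Fin K) : ℝ :=
  τ - 3 * S / 4 + S * min (((k : ℕ) + 1 : ℝ) / 2 ^ j) 1

theorem concave_rampMean {K : ℕ} (τ : ℝ) {S : ℝ} (hS : 0 ≤ S) (j : ℕ) (v : NNReal) :
    (gaussianBandit (rampMean K τ S j) v).concave := by
  intro k h0 h1
  simp only [mean_gaussianBandit, rampMean]
  have h2 : (0 : ℝ) < 2 ^ j := by positivity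
  obtain ⟨i, rfl⟩ : ∃ i, k = i + 1 := ⟨k - 1, by omega⟩
  simp only [Nat.add_sub_cancel]
  push_cast
  have h : min (((i : ℝ) + 1) / 2 ^ j) 1 + min (((i : ℝ) + 1 + 1 + 1) / 2 ^ j) 1
      ≤ 2 * min (((i : ℝ) + 1 + 1) / 2 ^ j) 1 := by
    rw [mul_min_of_nonneg _ _ zero_le_two]
    refine le_min ?_ ?_
    · refine (add_le_add (min_le_left _ _) (min_le_left _ _)).trans_eq ?_
      ring
    · exact (add_le_add (min_le_right _ _) (min_le_right _ _)).trans (by norm_num)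
  nlinarith

theorem sq_rampMean_sub_le {K : ℕ} (τ S : ℝ) (j : ℕ) (k : Fin K) :
    (rampMean K τ S j k - (τ - S / 4)) ^ 2 ≤ S ^ 2 / 4 := by
  set u : ℝ := min (((k : ℕ) + 1 : ℝ) / 2 ^ j) 1
  have h0 : 0 ≤ u := by positivity
  have h1 : u ≤ 1 := min_le_right _ _
  have : rampMean K τ S j k - (τ - S / 4) = S * (u - 1 / 2) := by
    rw [rampMean]; ring
  rw [this, mul_pow]
  nlinarith [sq_nonneg S, mul_nonneg h0 (sub_nonneg.2 h1)]

theorem rampMean_self {K : ℕ} (τ S : ℝ) (j : ℕ) (h : 2 ^ j - 1 < K) :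
    rampMean K τ S j ⟨2 ^ j - 1, h⟩ = τ + S / 4 := by
  have : ((2 ^ j - 1 : ℕ) : ℝ) + 1 = 2 ^ j := by
    rw [Nat.cast_pred (by positivity)]; push_cast; ring
  simp only [rampMean, this]
  rw [div_self (by positivity), min_self]
  ring

theorem rampMean_le {K : ℕ} (τ : ℝ) {S : ℝ} (hS : 0 ≤ S) {i j : ℕ} (hij : i < j)
    (h : 2 ^ i - 1 < K) : rampMean K τ S j ⟨2 ^ i - 1, h⟩ ≤ τ - S / 4 := by
  have h1 : ((2 ^ i - 1 : ℕ) : ℝ) + 1 = 2 ^ i := by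
    rw [Nat.cast_pred (by positivity)]; push_cast; ring
  have h2 : (2 : ℝ) ^ i / 2 ^ j ≤ 1 / 2 := by
    rw [div_le_div_iff₀ (by positivity) two_pos, one_mul, ← pow_succ]
    exact pow_le_pow_right₀ one_le_two hij
  simp only [rampMean, h1]
  nlinarith [(min_le_left ((2 : ℝ) ^ i / 2 ^ j) 1).trans h2]

theorem ramp_le_regret {K : ℕ} (τ : ℝ) {S : ℝ} (hS : 0 < S) (v : NNReal) {j : ℕ}
    (a : ℕ → Fin K) (ha : ∀ i ≤ j, (a i : ℕ) = 2 ^ i - 1) {Q : Fin K → Bool}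
    (hQ : ¬(Q (a j) = true ∧ ∀ i < j, Q (a i) = false)) :
    S / 4 ≤ regret (gaussianBandit (rampMean K τ S j) v) τ Q := by
  have hi {i : ℕ} (hij : i < j) : rampMean K τ S j (a i) ≤ τ - S / 4 := by
    have h : a i = ⟨2 ^ i - 1, ha i hij.le ▸ (a i).2⟩ := Fin.ext (ha i hij.le)
    rw [h]
    exact rampMean_le τ hS.le hij _
  have hj : rampMean K τ S j (a j) = τ + S / 4 := by
    have h : a j = ⟨2 ^ j - 1, ha j le_rfl ▸ (a j).2⟩ := Fin.ext (ha j le_rfl)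
    rw [h]
    exact rampMean_self τ S j _
  by_cases hQj : Q (a j) = true
  · obtain ⟨i, hij, hQi⟩ : ∃ i < j, Q (a i) = true := by simpa [hQj] using hQ
    refine le_trans ?_ (abs_gap_le_regret _ τ (k := a i) ?_)
    · rw [mean_gaussianBandit]
      exact le_trans (by linarith [hi hij]) (le_abs_self _)
    · simp [trueQ, hQi]
      linarith [hi hij]
  · refine le_trans ?_ (abs_gap_le_regret _ τ (k := a j) ?_)
    · rw [mean_gaussianBandit, hj]
      exact le_trans (by linarith) (neg_le_abs _)
    · simp [trueQ, hQj, hj]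
      linarith

theorem exists_measureReal_le_inv {Ω : Type*} [MeasurableSpace Ω] (μ : Measure Ω)
    [IsProbabilityMeasure μ] {A : ℕ → Set Ω} (hA : ∀ i, MeasurableSet (A i))
    (hd : Pairwise (Function.onFun Disjoint A)) {M : ℕ} (hM : 0 < M) :
    ∃ j < M, μ.real (A j) ≤ (M : ℝ)⁻¹ := by
  by_contra! h
  have hlt := Finset.sum_lt_sum_of_nonempty (s := Finset.range M) (by simpa using hM.ne')
    fun i hi => h i (Finset.mem_range.1 hi)
  rw [← measureReal_biUnion_finset (fun i _ j _ hij => hd hij) fun i _ => hA i] at hlt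
  simp only [Finset.sum_const, Finset.card_range, nsmul_eq_mul] at hlt
  rw [mul_inv_cancel₀ (by positivity)] at hlt
  exact hlt.not_ge measureReal_le_one

theorem two_le_log_log_sub_one {x : ℝ} (hx : exp 12 ≤ x) : 2 ≤ log (log x - 1) := by
  have h12 : 12 ≤ log x := (le_log_iff_exp_le ((exp_pos _).trans_le hx)).2 hx
  rw [le_log_iff_exp_le (by linarith)]
  have : exp 2 = exp 1 * exp 1 := by rw [← exp_add]; norm_num
  rw [this]
  nlinarith [exp_one_lt_d9, exp_pos 1]

theorem log_le_natLog_two_add_one {K : ℕ} (hK : 0 < K) : log K ≤ (Nat.log 2 K + 1 : ℕ) := by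
  have h : (K : ℝ) ≤ 2 ^ (Nat.log 2 K + 1) := by
    exact_mod_cast (Nat.lt_pow_succ_log_self one_lt_two K).le
  have h2 := log_le_log (by positivity) h
  rw [log_pow] at h2
  refine h2.trans (mul_le_of_le_one_right (by positivity) ?_)
  linarith [log_two_lt_d9]

end TBP

open TBP in
/-- Minimax lower bound for the concave thresholding bandit problem. -/
theorem concave_lower_bound (K T : ℕ) (σ τ : ℝ) (hK : Real.exp 12 ≤ (K : ℝ)) (hT : 1 ≤ T)
    (hσ : 0 < σ) (alg : Strategy K T) :
    ∃ ν : Bandit K, ν.isGaussian σ ∧ ν.concave ∧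
      1 / 8 * Real.sqrt (σ ^ 2 * max 2 (Real.log (Real.log K - 1)) / (8 * T))
        ≤ expRegret ν alg τ := by
  have hL := two_le_log_log_sub_one hK
  rw [max_eq_right hL]
  have hK0 : 0 < K := by exact_mod_cast (exp_pos 12).trans_le hK
  have hT0 : (0 : ℝ) < T := by exact_mod_cast hT
  have hM : exp (log (log K - 1)) ≤ (Nat.log 2 K + 1 : ℕ) := by
    have h12 : 12 ≤ log K := (le_log_iff_exp_le (by positivity)).2 hK
    rw [exp_log (by linarith)]
    linarith [log_le_natLog_two_add_one hK0]
  set L := log (log K - 1)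
  set M := Nat.log 2 K + 1
  set δ := √(σ ^ 2 * L / (8 * T))
  have hδ0 : 0 < δ := by positivity
  have hδ2 : δ ^ 2 = σ ^ 2 * L / (8 * T) := Real.sq_sqrt (by positivity)
  let v : NNReal := ⟨σ ^ 2, sq_nonneg σ⟩
  have hv : v ≠ 0 := fun h => (pow_pos hσ 2).ne' (congrArg NNReal.toReal h)
  let a : ℕ → Fin K := fun i => ⟨(2 ^ i - 1) % K, Nat.mod_lt _ hK0⟩
  have ha {i : ℕ} (hi : i < M) : (a i : ℕ) = 2 ^ i - 1 := by
    have := (Nat.pow_le_pow_right two_pos (Nat.lt_succ_iff.1 hi)).trans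
      (Nat.pow_log_le_self 2 hK0.ne')
    exact Nat.mod_eq_of_lt (by omega)
  let B : ℕ → Set (Fin K → Bool) := fun j => {Q | Q (a j) = true ∧ ∀ i < j, Q (a i) = false}
  let A : ℕ → Set (Fin T → ℝ) := fun j => alg.decision ⁻¹' B j
  have hA (j : ℕ) : MeasurableSet (A j) := alg.decision_meas (Set.toFinite _).measurableSet
  have hd : Pairwise (Function.onFun Disjoint A) := by
    refine (pairwise_disjoint_on A).2 fun i j hij => Set.disjoint_left.2 fun x hi hj => ?_
    exact absurd (hi.1.symm.trans (hj.2 i hij)) (by simp)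
  have := isProbabilityMeasure_traj (gaussianBandit (K := K) (fun _ => τ - 2 * δ / 4) v)
    alg.policy_meas T
  obtain ⟨j, hjM, hj⟩ := exists_measureReal_le_inv
    (traj (gaussianBandit (K := K) (fun _ => τ - 2 * δ / 4) v) alg.policy T) hA hd
    (Nat.succ_pos _ : 0 < M)
  refine ⟨gaussianBandit (rampMean K τ (2 * δ) j) v, ⟨_, fun _ => rfl⟩,
    concave_rampMean τ (by positivity) j v, ?_⟩
  have hreg := mul_le_expRegret (gaussianBandit (rampMean K τ (2 * δ) j) v) alg (τ := τ) (hA j)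
    fun x hx => ramp_le_regret τ (by positivity) v a (fun i hi => ha (hi.trans_lt hjM)) hx
  have hsq := sq_traj_real_le alg (rampMean K τ (2 * δ) j) (τ - 2 * δ / 4) hv (D := L / (8 * T))
    (fun k => by
      have h := sq_rampMean_sub_le τ (2 * δ) j k
      have hvσ : (v : ℝ) = σ ^ 2 := rfl
      rw [hvσ, div_le_iff₀ (by positivity)]
      calc _ ≤ _ := h
        _ = δ ^ 2 := by ring
        _ = _ := by rw [hδ2]; ring) (hA j)
  set P := (traj (gaussianBandit (rampMean K τ (2 * δ) j) v) alg.policy T).real (A j)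
  have hP : P ^ 2 ≤ 9 / 16 := by
    calc P ^ 2 ≤ exp (T * (L / (8 * T))) * (exp L)⁻¹ := hsq.trans (by
          gcongr
          exact hj.trans (inv_anti₀ (exp_pos _) hM))
      _ = (exp (7 / 8 * L))⁻¹ := by
          rw [← exp_neg, ← exp_add, ← exp_neg]
          congr 1
          field_simp
          ring
      _ ≤ (16 / 9)⁻¹ := by
          refine inv_anti₀ (by norm_num) ?_
          linarith [add_one_le_exp (7 / 8 * L)]
      _ = 9 / 16 := by norm_num
  have hP' : P ≤ 3 / 4 := by nlinarith
  nlinarith
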